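/- arXiv:2206.02869 — 2 statements merged into one kernel-verified Lean document; each statement's English description precedes it below -/
import Mathlib

section
/- Let P = ([x*], [y*]) ∈ ℙᵐ × ℙⁿ, let g ∈ ℂ[u, x₀, …, x_m, v, y₀, …, y_n] be bihomogeneous of bidegree (d, e) with d, e ≥ 1 in the variable groups (u, x) and (v, y), let ℓ ∈ ℂ[y₀, …, y_n] be homogeneous of degree 1 with ℓ(y*) ≠ 0, and let ε ∈ (0, 1). Fix a representative y* and set v* := (1 − ε)·ℓ(y*)/ε, and assume g(1, 𝟎, v*, y*) ≠ 0. Then the intersection of the double cone P̃ of {P} with V(g, ε·v − (1 − ε)·ℓ(y)) in ℙ^{m+1} × ℙ^{n+1} equals { ([u : x*], [v* : y*]) : u ∈ ℂ, g(u, x*, v*, y*) = 0 }. (All stated conditions and the resulting set are independent of the chosen representatives x*, y*, since rescaling y* by μ rescales v* by μ.) -/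
open MvPolynomial

noncomputable section

namespace UGen

/-- The (quotient of the Euclidean) topology on the projectivization of `ℂ^N`. -/
instance {N : ℕ} : TopologicalSpace (Projectivization ℂ (Fin N → ℂ)) :=
  inferInstanceAs (TopologicalSpace (Quotient (projectivizationSetoid ℂ (Fin N → ℂ))))

lemma cons_ne_zero {N : ℕ} (u : ℂ) {x : Fin N → ℂ} (hx : x ≠ 0) :
    (Fin.cons u x : Fin (N + 1) → ℂ) ≠ 0 := by
  intro h
  apply hx
  funext i
  simpa using congrFun h i.succ

lemma one_zero_ne_zero {N : ℕ} : (Fin.cons 1 0 : Fin (N + 1) → ℂ) ≠ 0 := by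
  intro h
  simpa using congrFun h 0

/-- The distinguished point `[1 : 0 : ⋯ : 0]`. -/
def e0 {N : ℕ} : Projectivization ℂ (Fin (N + 1) → ℂ) :=
  Projectivization.mk ℂ (Fin.cons 1 0) one_zero_ne_zero

/-- The vanishing locus in `ℙ^{N-1}` of a polynomial in `N` variables (for homogeneous
polynomials vanishing does not depend on the representative; we require vanishing at
every representative). -/
def Vp {N : ℕ} (h : MvPolynomial (Fin N) ℂ) : Set (Projectivization ℂ (Fin N → ℂ)) :=
  { p | ∀ (w : Fin N → ℂ) (hw : w ≠ 0), p = Projectivization.mk ℂ w hw → eval w h = 0 }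

/-- The "open part" of the cone over `X ⊆ ℙⁿ`: all points `[u : x]` with `[x] ∈ X`. -/
def coneO {n : ℕ} (X : Set (Projectivization ℂ (Fin (n + 1) → ℂ))) :
    Set (Projectivization ℂ (Fin (n + 2) → ℂ)) :=
  { q | ∃ (u : ℂ) (x : Fin (n + 1) → ℂ) (hx : x ≠ 0),
      Projectivization.mk ℂ x hx ∈ X ∧
        q = Projectivization.mk ℂ (Fin.cons u x) (cons_ne_zero u hx) }

/-- The cone `X̃ ⊆ ℙ^{n+1}` over `X ⊆ ℙⁿ`. -/
def cone {n : ℕ} (X : Set (Projectivization ℂ (Fin (n + 1) → ℂ))) :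
    Set (Projectivization ℂ (Fin (n + 2) → ℂ)) :=
  coneO X ∪ {e0}

end UGen

namespace UGen

lemma cons_pair_ne_zero {N : ℕ} {a b : ℂ} (hab : (a, b) ≠ (0, 0)) {x : Fin N → ℂ}
    (hx : x ≠ 0) : (Fin.cons a (b • x) : Fin (N + 1) → ℂ) ≠ 0 := by
  rcases eq_or_ne b 0 with hb | hb
  · subst hb
    have ha : a ≠ 0 := by simpa using hab
    intro h
    exact ha (by simpa using congrFun h 0)
  · exact cons_ne_zero a (smul_ne_zero hb hx)

/-- Bihomogeneity of bidegree `(d, e)` in two groups of variables,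
phrased via weighted homogeneity with weights `(1,0)` and `(0,1)`. -/
def IsBihomogeneous {a b : ℕ} (g : MvPolynomial (Fin a ⊕ Fin b) ℂ) (d e : ℕ) : Prop :=
  g.IsWeightedHomogeneous
    (Sum.elim (fun _ => ((1 : ℕ), (0 : ℕ))) (fun _ => ((0 : ℕ), (1 : ℕ)))) (d, e)

/-- The vanishing locus, in a product of two projectivizations, of a polynomial in the two
groups of variables (for bihomogeneous polynomials vanishing does not depend on the chosen
representatives; we require vanishing at every pair of representatives). -/
def Vbi {a b : ℕ} (h : MvPolynomial (Fin a ⊕ Fin b) ℂ) :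
    Set (Projectivization ℂ (Fin a → ℂ) × Projectivization ℂ (Fin b → ℂ)) :=
  { p | ∀ (w₁ : Fin a → ℂ) (h₁ : w₁ ≠ 0) (w₂ : Fin b → ℂ) (h₂ : w₂ ≠ 0),
      p = (Projectivization.mk ℂ w₁ h₁, Projectivization.mk ℂ w₂ h₂) →
        eval (Sum.elim w₁ w₂) h = 0 }

variable {m n : ℕ}
  (X : Set (Projectivization ℂ (Fin (m + 1) → ℂ) × Projectivization ℂ (Fin (n + 1) → ℂ)))

/-- The "open part" of the double cone: all points `([u : x], [v : y])` with `([x],[y]) ∈ X`. -/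
def dcT : Set (Projectivization ℂ (Fin (m + 2) → ℂ) × Projectivization ℂ (Fin (n + 2) → ℂ)) :=
  { q | ∃ (u v : ℂ) (x : Fin (m + 1) → ℂ) (y : Fin (n + 1) → ℂ) (hx : x ≠ 0) (hy : y ≠ 0),
      (Projectivization.mk ℂ x hx, Projectivization.mk ℂ y hy) ∈ X ∧
        q = (Projectivization.mk ℂ (Fin.cons u x) (cons_ne_zero u hx),
             Projectivization.mk ℂ (Fin.cons v y) (cons_ne_zero v hy)) }

/-- The part `{([u : x], [1 : 𝟎]) : [x] ∈ π_x(X)}` of the double cone. -/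
def dcA : Set (Projectivization ℂ (Fin (m + 2) → ℂ) × Projectivization ℂ (Fin (n + 2) → ℂ)) :=
  { q | ∃ (u : ℂ) (x : Fin (m + 1) → ℂ) (hx : x ≠ 0),
      Projectivization.mk ℂ x hx ∈ Prod.fst '' X ∧
        q = (Projectivization.mk ℂ (Fin.cons u x) (cons_ne_zero u hx), e0) }

/-- The part `{([1 : 𝟎], [v : y]) : [y] ∈ π_y(X)}` of the double cone. -/
def dcB : Set (Projectivization ℂ (Fin (m + 2) → ℂ) × Projectivization ℂ (Fin (n + 2) → ℂ)) :=
  { q | ∃ (v : ℂ) (y : Fin (n + 1) → ℂ) (hy : y ≠ 0),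
      Projectivization.mk ℂ y hy ∈ Prod.snd '' X ∧
        q = (e0, Projectivization.mk ℂ (Fin.cons v y) (cons_ne_zero v hy)) }

/-- The double cone `X̃ ⊆ ℙ^{m+1} × ℙ^{n+1}` of `X ⊆ ℙᵐ × ℙⁿ`. -/
def doubleCone :
    Set (Projectivization ℂ (Fin (m + 2) → ℂ) × Projectivization ℂ (Fin (n + 2) → ℂ)) :=
  dcT X ∪ dcA X ∪ dcB X ∪ {(e0, e0)}

end UGen

namespace UGen

lemma IsBihomogeneous.eval_smul {a b d e : ℕ} {g : MvPolynomial (Fin a ⊕ Fin b) ℂ}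
    (hg : IsBihomogeneous g d e) (r s : ℂ) (w₁ : Fin a → ℂ) (w₂ : Fin b → ℂ) :
    eval (Sum.elim (r • w₁) (s • w₂)) g = r ^ d * s ^ e * eval (Sum.elim w₁ w₂) g := by
  rw [eval_eq', eval_eq', Finset.mul_sum]
  refine Finset.sum_congr rfl fun c hc => ?_
  have hw := hg (mem_support_iff.mp hc)
  rw [Finsupp.weight_apply, Finsupp.sum_fintype _ _ (by simp), Fintype.sum_sum_type] at hw
  have h₁ : ∑ i, c (Sum.inl i) = d := by simpa [Prod.fst_sum] using congrArg Prod.fst hw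
  have h₂ : ∑ i, c (Sum.inr i) = e := by simpa [Prod.snd_sum] using congrArg Prod.snd hw
  simp only [Fintype.prod_sum_type, Sum.elim_inl, Sum.elim_inr, Pi.smul_apply, smul_eq_mul,
    mul_pow, Finset.prod_mul_distrib, Finset.prod_pow_eq_pow_sum, h₁, h₂]
  ring

lemma mk_mem_Vbi_iff {a b d e : ℕ} {g : MvPolynomial (Fin a ⊕ Fin b) ℂ}
    (hg : IsBihomogeneous g d e) {w₁ : Fin a → ℂ} (h₁ : w₁ ≠ 0) {w₂ : Fin b → ℂ}
    (h₂ : w₂ ≠ 0) :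
    (Projectivization.mk ℂ w₁ h₁, Projectivization.mk ℂ w₂ h₂) ∈ Vbi g ↔
      eval (Sum.elim w₁ w₂) g = 0 := by
  refine ⟨fun h => h w₁ h₁ w₂ h₂ rfl, fun h z₁ k₁ z₂ k₂ hz => ?_⟩
  rw [Prod.mk.injEq, eq_comm, Projectivization.mk_eq_mk_iff',
    eq_comm (a := Projectivization.mk _ _ _), Projectivization.mk_eq_mk_iff'] at hz
  obtain ⟨⟨r, rfl⟩, s, rfl⟩ := hz
  rw [hg.eval_smul, h, mul_zero]

lemma isBihomogeneous_rename_inr {a b e : ℕ} {p : MvPolynomial (Fin b) ℂ}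
    (hp : p.IsHomogeneous e) :
    IsBihomogeneous (rename (Sum.inr ∘ Fin.succ : Fin b → Fin a ⊕ Fin (b + 1)) p) 0 e := by
  intro c hc
  obtain ⟨c', rfl, hc'⟩ := coeff_rename_ne_zero _ _ _ hc
  have h := hp hc'
  rw [Finsupp.weight_apply, Finsupp.sum_fintype _ _ (by simp)] at h
  rw [Finsupp.weight_apply, Finsupp.sum_mapDomain_index (by simp) (by simp [add_smul]),
    Finsupp.sum_fintype _ _ (by simp)]
  ext
  · simp [Prod.fst_sum]
  · simpa [Prod.snd_sum] using h

/-- The bihomogeneous linear form `α v - β ℓ(y)`. -/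
lemma isBihomogeneous_linear {a b : ℕ} {ℓ : MvPolynomial (Fin b) ℂ} (hℓ : ℓ.IsHomogeneous 1)
    (α β : ℂ) :
    IsBihomogeneous (C α * X (Sum.inr 0) - C β * rename (Sum.inr ∘ Fin.succ) ℓ :
      MvPolynomial (Fin a ⊕ Fin (b + 1)) ℂ) 0 1 := by
  rw [IsBihomogeneous, ← mem_weightedHomogeneousSubmodule, ← smul_eq_C_mul, ← smul_eq_C_mul]
  refine Submodule.sub_mem _ (Submodule.smul_mem _ _ ?_) (Submodule.smul_mem _ _ ?_)
  · exact isWeightedHomogeneous_X ℂ _ (Sum.inr 0)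
  · exact isBihomogeneous_rename_inr hℓ

lemma eval_linear_cons {a b : ℕ} (ℓ : MvPolynomial (Fin b) ℂ) (α β v : ℂ) (w : Fin a → ℂ)
    (y : Fin b → ℂ) :
    eval (Sum.elim w (Fin.cons v y : Fin (b + 1) → ℂ))
      (C α * X (Sum.inr 0) - C β * rename (Sum.inr ∘ Fin.succ) ℓ) =
      α * v - β * eval y ℓ := by
  have : (Sum.elim w (Fin.cons v y : Fin (b + 1) → ℂ)) ∘ (Sum.inr ∘ Fin.succ) = y := by
    ext i; simp
  simp [eval_rename, this]

lemma smul_cons {N : ℕ} (r u : ℂ) (x : Fin N → ℂ) :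
    r • (Fin.cons u x : Fin (N + 1) → ℂ) = Fin.cons (r * u) (r • x) := by
  ext i
  refine Fin.cases ?_ (fun j => ?_) i <;> simp

/-- A point `[u : x]` over `[x₀]` has a representative `[u' : x₀]`. -/
lemma exists_mk_cons_eq {N : ℕ} {x x₀ : Fin N → ℂ} (hx : x ≠ 0) (hx₀ : x₀ ≠ 0)
    (h : Projectivization.mk ℂ x hx = Projectivization.mk ℂ x₀ hx₀) (u : ℂ) :
    ∃ u' : ℂ, Projectivization.mk ℂ (Fin.cons u x : Fin (N + 1) → ℂ) (cons_ne_zero u hx) =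
      Projectivization.mk ℂ (Fin.cons u' x₀ : Fin (N + 1) → ℂ) (cons_ne_zero u' hx₀) := by
  obtain ⟨r, rfl⟩ := (Projectivization.mk_eq_mk_iff' ..).mp h
  have hr : r ≠ 0 := fun h0 => hx (by simp [h0])
  refine ⟨r⁻¹ * u, (Projectivization.mk_eq_mk_iff' ..).mpr ⟨r, ?_⟩⟩
  rw [smul_cons, mul_inv_cancel_left₀ hr]

/-- The double cone of a point is the product of the cones over its two coordinates. -/
lemma mem_doubleCone_singleton {m n : ℕ} {xs : Fin (m + 1) → ℂ} (hxs : xs ≠ 0)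
    {ys : Fin (n + 1) → ℂ} (hys : ys ≠ 0)
    {q : Projectivization ℂ (Fin (m + 2) → ℂ) × Projectivization ℂ (Fin (n + 2) → ℂ)} :
    q ∈ doubleCone {(Projectivization.mk ℂ xs hxs, Projectivization.mk ℂ ys hys)} ↔
      ((∃ u, q.1 = Projectivization.mk ℂ (Fin.cons u xs) (cons_ne_zero u hxs)) ∨ q.1 = e0) ∧
      ((∃ v, q.2 = Projectivization.mk ℂ (Fin.cons v ys) (cons_ne_zero v hys)) ∨ q.2 = e0) := by
  constructor
  · rintro (((⟨u, v, x, y, hx, hy, h, rfl⟩ | ⟨u, x, hx, ⟨_, rfl, h⟩, rfl⟩) |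
      ⟨v, y, hy, ⟨_, rfl, h⟩, rfl⟩) | rfl)
    · obtain ⟨h₁, h₂⟩ := Prod.mk.inj h
      exact ⟨.inl (exists_mk_cons_eq hx hxs h₁ u), .inl (exists_mk_cons_eq hy hys h₂ v)⟩
    · exact ⟨.inl (exists_mk_cons_eq hx hxs h.symm u), .inr rfl⟩
    · exact ⟨.inr rfl, .inl (exists_mk_cons_eq hy hys h.symm v)⟩
    · exact ⟨.inr rfl, .inr rfl⟩
  · obtain ⟨q₁, q₂⟩ := q
    rintro ⟨⟨u, rfl⟩ | rfl, ⟨v, rfl⟩ | rfl⟩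
    · exact .inl (.inl (.inl ⟨u, v, xs, ys, hxs, hys, rfl, rfl⟩))
    · exact .inl (.inl (.inr ⟨u, xs, hxs, ⟨_, rfl, rfl⟩, rfl⟩))
    · exact .inl (.inr ⟨v, ys, hys, ⟨_, rfl, rfl⟩, rfl⟩)
    · exact .inr rfl

end UGen

/-- Intersecting the double cone over a point `P = ([x*],[y*])` with
`V(g, ε·v − (1−ε)·ℓ(y))`: with `v* = (1−ε)ℓ(y*)/ε` (and `g(1,𝟎,v*,y*) ≠ 0`) the intersection
is `{([u : x*], [v* : y*]) : g(u, x*, v*, y*) = 0}`. -/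
theorem statement8 {m n d e : ℕ} (xs : Fin (m + 1) → ℂ) (hxs : xs ≠ 0)
    (ys : Fin (n + 1) → ℂ) (hys : ys ≠ 0)
    (g : MvPolynomial (Fin (m + 2) ⊕ Fin (n + 2)) ℂ)
    (hg : UGen.IsBihomogeneous g d e) (hd : 1 ≤ d) (he : 1 ≤ e)
    (ℓ : MvPolynomial (Fin (n + 1)) ℂ) (hℓ : ℓ.IsHomogeneous 1)
    (hℓys : eval ys ℓ ≠ 0)
    (ε : ℝ) (hε : ε ∈ Set.Ioo (0 : ℝ) 1)
    (hgv : eval (Sum.elim (Fin.cons 1 0)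
        (Fin.cons ((1 - (ε : ℂ)) * eval ys ℓ / (ε : ℂ)) ys)) g ≠ 0) :
    UGen.doubleCone {(Projectivization.mk ℂ xs hxs, Projectivization.mk ℂ ys hys)} ∩
        UGen.Vbi g ∩
        UGen.Vbi (C (ε : ℂ) * MvPolynomial.X (Sum.inr 0) -
          C (1 - (ε : ℂ)) * rename (Sum.inr ∘ Fin.succ) ℓ) =
      { q | ∃ u : ℂ,
          eval (Sum.elim (Fin.cons u xs)
            (Fin.cons ((1 - (ε : ℂ)) * eval ys ℓ / (ε : ℂ)) ys)) g = 0 ∧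
          q = (Projectivization.mk ℂ (Fin.cons u xs) (UGen.cons_ne_zero u hxs),
               Projectivization.mk ℂ
                 (Fin.cons ((1 - (ε : ℂ)) * eval ys ℓ / (ε : ℂ)) ys)
                 (UGen.cons_ne_zero _ hys)) } := by
  have hε₀ : (ε : ℂ) ≠ 0 := by exact_mod_cast hε.1.ne'
  have hℓ₀ : eval 0 ℓ = 0 := by
    have h := hℓ.coeff_eq_zero (d := 0) (by simp)
    rwa [← constantCoeff_eq, ← eval_zero] at h
  ext ⟨q₁, q₂⟩
  simp only [Set.mem_inter_iff, UGen.mem_doubleCone_singleton, Set.mem_ofPred_eq, Prod.mk.injEq]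
  constructor
  · rintro ⟨⟨⟨h₁, ⟨v, rfl⟩ | rfl⟩, hqg⟩, hql⟩
    · have hv : v = (1 - (ε : ℂ)) * eval ys ℓ / ε := by
        have hv' : (ε : ℂ) * v - (1 - (ε : ℂ)) * eval ys ℓ = 0 := by
          obtain ⟨u, rfl⟩ | rfl := h₁ <;>
          · rw [← UGen.eval_linear_cons]
            exact (UGen.mk_mem_Vbi_iff (UGen.isBihomogeneous_linear hℓ _ _) _ _).mp hql
        rw [eq_div_iff hε₀]
        linear_combination hv'
      subst hv
      obtain ⟨u, rfl⟩ | rfl := h₁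
      · exact ⟨u, (UGen.mk_mem_Vbi_iff hg _ _).mp hqg, rfl, rfl⟩
      · exact absurd ((UGen.mk_mem_Vbi_iff hg _ _).mp hqg) hgv
    · refine absurd ?_ hε₀
      obtain ⟨u, rfl⟩ | rfl := h₁ <;>
      · have h := (UGen.mk_mem_Vbi_iff (UGen.isBihomogeneous_linear hℓ _ _) _ _).mp hql
        rw [UGen.eval_linear_cons, hℓ₀] at h
        simpa using h
  · rintro ⟨u, hu, rfl, rfl⟩
    refine ⟨⟨⟨.inl ⟨u, rfl⟩, .inl ⟨_, rfl⟩⟩, (UGen.mk_mem_Vbi_iff hg _ _).mpr hu⟩, ?_⟩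
    rw [UGen.mk_mem_Vbi_iff (UGen.isBihomogeneous_linear hℓ _ _), UGen.eval_linear_cons]
    field_simp
    ring
end
end

section
/- Let X ⊆ ℙᵐ × ℙⁿ be a closed subset, let ℓ_x ∈ ℂ[x₀, …, x_m] and ℓ_y ∈ ℂ[y₀, …, y_n] be homogeneous of degree 1, and let t ∈ (0, 1]. Then the map ([x], [y]) ↦ ([−(1−t)ℓ_x(x) : t·x], [−(1−t)ℓ_y(y) : t·y]) is a well-defined bijection from X onto X̃ ∩ V((1−t)ℓ_x + t·u, (1−t)ℓ_y + t·v). -/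
open MvPolynomial

noncomputable section

namespace UGen

lemma eval_smul_of_isHomogeneous_one {N : ℕ} {ℓ : MvPolynomial (Fin N) ℂ}
    (hℓ : ℓ.IsHomogeneous 1) (a : ℂ) (x : Fin N → ℂ) : eval (a • x) ℓ = a * eval x ℓ := by
  rw [eval_eq, eval_eq, Finset.mul_sum]
  refine Finset.sum_congr rfl fun d hd => ?_
  have hdeg : ∑ i ∈ d.support, d i = 1 := by
    simpa [Finsupp.weight_apply, Finsupp.sum] using hℓ (mem_support_iff.mp hd)
  simp only [Pi.smul_apply, smul_eq_mul, mul_pow, Finset.prod_mul_distrib,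
    Finset.prod_pow_eq_pow_sum, hdeg, pow_one]
  ring

lemma cons_smul {N : ℕ} (a u : ℂ) (x : Fin N → ℂ) :
    a • (Fin.cons u x : Fin (N + 1) → ℂ) = Fin.cons (a * u) (a • x) := by
  funext i
  refine Fin.cases ?_ (fun j => ?_) i <;> simp

/-- The map `[x] ↦ [-(1-s) ℓ(x) : s • x]`. -/
def hyperplaneLift {N : ℕ} (ℓ : MvPolynomial (Fin N) ℂ) {s : ℂ} (hs : s ≠ 0)
    (p : Projectivization ℂ (Fin N → ℂ)) : Projectivization ℂ (Fin (N + 1) → ℂ) :=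
  Projectivization.mk ℂ (Fin.cons (-(1 - s) * eval p.rep ℓ) (s • p.rep))
    (cons_ne_zero _ (smul_ne_zero hs p.rep_nonzero))

section

variable {N : ℕ} {ℓ : MvPolynomial (Fin N) ℂ} {s : ℂ}

lemma hyperplaneLift_mk (hℓ : ℓ.IsHomogeneous 1) (hs : s ≠ 0) (x : Fin N → ℂ) (hx : x ≠ 0) :
    hyperplaneLift ℓ hs (Projectivization.mk ℂ x hx) =
      Projectivization.mk ℂ (Fin.cons (-(1 - s) * eval x ℓ) (s • x))
        (cons_ne_zero _ (smul_ne_zero hs hx)) := by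
  obtain ⟨a, ha⟩ := Projectivization.exists_smul_eq_mk_rep ℂ x hx
  refine (Projectivization.mk_eq_mk_iff' ℂ _ _ _ _).mpr ⟨a, ?_⟩
  rw [← ha, cons_smul, Units.smul_def, eval_smul_of_isHomogeneous_one hℓ, smul_comm s]
  congr 1
  ring

lemma hyperplaneLift_injective (ℓ : MvPolynomial (Fin N) ℂ) (hs : s ≠ 0) :
    Function.Injective (hyperplaneLift ℓ hs) := by
  intro p q h
  obtain ⟨a, ha⟩ := (Projectivization.mk_eq_mk_iff' ℂ _ _ _ _).mp h
  rw [← p.mk_rep, ← q.mk_rep, Projectivization.mk_eq_mk_iff']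
  refine ⟨a, smul_right_injective _ hs ?_⟩
  rw [cons_smul] at ha
  simpa [smul_comm s a] using (Fin.cons_injective2 ha).2

lemma hyperplaneLift_mk_eq (hℓ : ℓ.IsHomogeneous 1) (hs : s ≠ 0) (u : ℂ) (x : Fin N → ℂ)
    (hx : x ≠ 0) (h : (1 - s) * eval x ℓ + s * u = 0) :
    hyperplaneLift ℓ hs (Projectivization.mk ℂ x hx) =
      Projectivization.mk ℂ (Fin.cons u x) (cons_ne_zero u hx) := by
  rw [hyperplaneLift_mk hℓ]
  refine (Projectivization.mk_eq_mk_iff' ℂ _ _ _ _).mpr ⟨s, ?_⟩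
  rw [cons_smul]
  congr 1
  linear_combination h

lemma hyperplane_eq_zero_of_hyperplaneLift (hℓ : ℓ.IsHomogeneous 1) (hs : s ≠ 0)
    (p : Projectivization ℂ (Fin N → ℂ)) (w : Fin (N + 1) → ℂ) (hw : w ≠ 0)
    (h : hyperplaneLift ℓ hs p = Projectivization.mk ℂ w hw) :
    (1 - s) * eval (w ∘ Fin.succ) ℓ + s * w 0 = 0 := by
  obtain ⟨a, ha⟩ := (Projectivization.mk_eq_mk_iff' ℂ _ _ _ _).mp h.symm
  rw [cons_smul] at ha
  have hsucc : w ∘ Fin.succ = (a * s) • p.rep := by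
    rw [← ha]
    funext i
    simp [mul_assoc]
  rw [hsucc, eval_smul_of_isHomogeneous_one hℓ, ← ha, Fin.cons_zero]
  ring

lemma e0_not_mem_hyperplane (hℓ : ℓ.IsHomogeneous 1) (hs : s ≠ 0) :
    (1 - s) * eval (0 : Fin N → ℂ) ℓ + s * 1 ≠ 0 := by
  have h := eval_smul_of_isHomogeneous_one hℓ 0 0
  rw [zero_smul, zero_mul] at h
  rwa [h, mul_zero, zero_add, mul_one]

end

end UGen

/-- For `t ∈ (0,1]`, the map
`([x],[y]) ↦ ([−(1−t)ℓ_x(x) : t·x], [−(1−t)ℓ_y(y) : t·y])` is a well-defined bijection from `X`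
onto `X̃ ∩ V((1−t)ℓ_x + t·u, (1−t)ℓ_y + t·v)`. -/
theorem statement11 {m n : ℕ}
    (X : Set (Projectivization ℂ (Fin (m + 1) → ℂ) × Projectivization ℂ (Fin (n + 1) → ℂ)))
    (hXcl : IsClosed X)
    (ℓx : MvPolynomial (Fin (m + 1)) ℂ) (hℓx : ℓx.IsHomogeneous 1)
    (ℓy : MvPolynomial (Fin (n + 1)) ℂ) (hℓy : ℓy.IsHomogeneous 1)
    (t : ℝ) (ht : t ∈ Set.Ioc (0 : ℝ) 1) :
    ∃ f : Projectivization ℂ (Fin (m + 1) → ℂ) × Projectivization ℂ (Fin (n + 1) → ℂ) →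
        Projectivization ℂ (Fin (m + 2) → ℂ) × Projectivization ℂ (Fin (n + 2) → ℂ),
      (∀ (x : Fin (m + 1) → ℂ) (hx : x ≠ 0) (y : Fin (n + 1) → ℂ) (hy : y ≠ 0),
        f (Projectivization.mk ℂ x hx, Projectivization.mk ℂ y hy) =
          (Projectivization.mk ℂ (Fin.cons (-(1 - (t : ℂ)) * eval x ℓx) ((t : ℂ) • x))
            (UGen.cons_ne_zero _
              (smul_ne_zero (Complex.ofReal_ne_zero.mpr ht.1.ne') hx)),
           Projectivization.mk ℂ (Fin.cons (-(1 - (t : ℂ)) * eval y ℓy) ((t : ℂ) • y))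
            (UGen.cons_ne_zero _
              (smul_ne_zero (Complex.ofReal_ne_zero.mpr ht.1.ne') hy)))) ∧
      Set.BijOn f X
        (UGen.doubleCone X ∩
          UGen.Vbi (C (1 - (t : ℂ)) * rename (Sum.inl ∘ Fin.succ) ℓx +
            C (t : ℂ) * MvPolynomial.X (Sum.inl 0)) ∩
          UGen.Vbi (C (1 - (t : ℂ)) * rename (Sum.inr ∘ Fin.succ) ℓy +
            C (t : ℂ) * MvPolynomial.X (Sum.inr 0))) := by
  have hs : (t : ℂ) ≠ 0 := Complex.ofReal_ne_zero.mpr ht.1.ne'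
  refine ⟨Prod.map (UGen.hyperplaneLift ℓx hs) (UGen.hyperplaneLift ℓy hs),
    fun x hx y hy => Prod.ext (UGen.hyperplaneLift_mk hℓx hs x hx)
      (UGen.hyperplaneLift_mk hℓy hs y hy), ?_, ?_, ?_⟩
  · rintro ⟨p, q⟩ hpq
    refine ⟨⟨Or.inl (Or.inl (Or.inl ⟨_, _, (t : ℂ) • p.rep, (t : ℂ) • q.rep,
      smul_ne_zero hs p.rep_nonzero, smul_ne_zero hs q.rep_nonzero, ?_, rfl⟩)), ?_⟩, ?_⟩
    · have hmk {N : ℕ} (r : Projectivization ℂ (Fin N → ℂ)) :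
          Projectivization.mk ℂ ((t : ℂ) • r.rep) (smul_ne_zero hs r.rep_nonzero) = r := by
        conv_rhs => rw [← r.mk_rep]
        exact (Projectivization.mk_eq_mk_iff' ℂ _ _ _ _).mpr ⟨t, rfl⟩
      rwa [hmk, hmk]
    · intro w₁ h₁ w₂ h₂ h
      simpa [eval_rename, ← Function.comp_assoc] using
        UGen.hyperplane_eq_zero_of_hyperplaneLift hℓx hs p w₁ h₁ (congrArg Prod.fst h)
    · intro w₁ h₁ w₂ h₂ h
      simpa [eval_rename, ← Function.comp_assoc] using
        UGen.hyperplane_eq_zero_of_hyperplaneLift hℓy hs q w₂ h₂ (congrArg Prod.snd h)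
  · exact ((UGen.hyperplaneLift_injective ℓx hs).prodMap
      (UGen.hyperplaneLift_injective ℓy hs)).injOn
  · have hcomp {N : ℕ} (u : ℂ) (x : Fin N → ℂ) :
        (Fin.cons u x : Fin (N + 1) → ℂ) ∘ Fin.succ = x := funext fun _ => rfl
    rintro z ⟨⟨hz, hzx⟩, hzy⟩
    rcases hz with ((⟨u, v, x, y, hx, hy, hX, rfl⟩ | ⟨u, x, hx, -, rfl⟩) | ⟨v, y, hy, -, rfl⟩) | rfl
    · have hu := hzx _ _ _ _ rfl
      have hv := hzy _ _ _ _ rfl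
      simp only [map_add, map_mul, eval_C, eval_X, eval_rename, ← Function.comp_assoc,
        Sum.elim_comp_inl, Sum.elim_comp_inr, Sum.elim_inl, Sum.elim_inr, Fin.cons_zero,
        hcomp] at hu hv
      exact ⟨_, hX, Prod.ext (UGen.hyperplaneLift_mk_eq hℓx hs u x hx hu)
        (UGen.hyperplaneLift_mk_eq hℓy hs v y hy hv)⟩
    · have hv := hzy _ _ _ _ rfl
      simp only [map_add, map_mul, eval_C, eval_X, eval_rename, ← Function.comp_assoc,
        Sum.elim_comp_inr, Sum.elim_inr, Fin.cons_zero, hcomp] at hv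
      exact absurd hv (UGen.e0_not_mem_hyperplane hℓy hs)
    all_goals
      have hu := hzx _ _ _ _ rfl
      simp only [map_add, map_mul, eval_C, eval_X, eval_rename, ← Function.comp_assoc,
        Sum.elim_comp_inl, Sum.elim_inl, Fin.cons_zero, hcomp] at hu
      exact absurd hu (UGen.e0_not_mem_hyperplane hℓx hs)
end
end
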